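/- Fix reals 0 < a < b < c and γ > 0, and let f: (0,∞) → ℝ be convex. Define F(t) := t·f(γ(t-a)/t) + (b-t)·f(γ(c-t)/(b-t)) for t ∈ (a, b). Then F is convex on (a, b). -/

import Mathlib

/-- The perspective `(u, w) ↦ w * f (u / w)` of a function convex on `(0, ∞)` is convex on the
positive quadrant. -/
theorem ConvexOn.perspective_le {f : ℝ → ℝ} (hf : ConvexOn ℝ (Set.Ioi (0 : ℝ)) f)
    {u₁ u₂ w₁ w₂ x y : ℝ} (hu₁ : 0 < u₁) (hu₂ : 0 < u₂) (hw₁ : 0 < w₁) (hw₂ : 0 < w₂)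
    (hx : 0 ≤ x) (hy : 0 ≤ y) (hxy : x + y = 1) :
    (x * w₁ + y * w₂) * f ((x * u₁ + y * u₂) / (x * w₁ + y * w₂)) ≤
      x * (w₁ * f (u₁ / w₁)) + y * (w₂ * f (u₂ / w₂)) := by
  have hW : 0 < x * w₁ + y * w₂ := convex_Ioi (0 : ℝ) hw₁ hw₂ hx hy hxy
  have h := hf.2 (Set.mem_Ioi.2 (div_pos hu₁ hw₁)) (Set.mem_Ioi.2 (div_pos hu₂ hw₂))
    (div_nonneg (mul_nonneg hx hw₁.le) hW.le) (div_nonneg (mul_nonneg hy hw₂.le) hW.le)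
    (by rw [← add_div, div_self hW.ne'])
  simp only [smul_eq_mul] at h
  have harg : x * w₁ / (x * w₁ + y * w₂) * (u₁ / w₁) + y * w₂ / (x * w₁ + y * w₂) * (u₂ / w₂) =
      (x * u₁ + y * u₂) / (x * w₁ + y * w₂) := by
    field_simp
  rw [harg] at h
  refine (mul_le_mul_of_nonneg_left h hW.le).trans_eq ?_
  field_simp

/-- Convexity claim in the proof of Lemma 5: for `0 < a < b < c`, `γ > 0` and
convex `f : (0,∞) → ℝ`, the function
`F(t) = t·f(γ(t-a)/t) + (b-t)·f(γ(c-t)/(b-t))` is convex on `(a, b)`. -/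
theorem stmt_17 (a b c γ : ℝ) (ha : 0 < a) (hab : a < b) (hbc : b < c)
    (hγ : 0 < γ) (f : ℝ → ℝ) (hconv : ConvexOn ℝ (Set.Ioi (0 : ℝ)) f) :
    ConvexOn ℝ (Set.Ioo a b)
      (fun t : ℝ => t * f (γ * (t - a) / t) + (b - t) * f (γ * (c - t) / (b - t))) := by
  refine ConvexOn.add ⟨convex_Ioo a b, ?_⟩ ⟨convex_Ioo a b, ?_⟩ <;>
    rintro s ⟨has, hsb⟩ t ⟨hat, htb⟩ x y hx hy hxy <;>
    simp only [smul_eq_mul]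
  · have hnum : γ * (x * s + y * t - a) = x * (γ * (s - a)) + y * (γ * (t - a)) := by
      linear_combination (γ * a) * hxy
    rw [hnum]
    exact hconv.perspective_le (mul_pos hγ (sub_pos.2 has)) (mul_pos hγ (sub_pos.2 hat))
      (ha.trans has) (ha.trans hat) hx hy hxy
  · have hden : b - (x * s + y * t) = x * (b - s) + y * (b - t) := by
      linear_combination (-b) * hxy
    have hnum : γ * (c - (x * s + y * t)) = x * (γ * (c - s)) + y * (γ * (c - t)) := by
      linear_combination (-(γ * c)) * hxy
    rw [hden, hnum]
    exact hconv.perspective_le (mul_pos hγ (sub_pos.2 (hsb.trans hbc)))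
      (mul_pos hγ (sub_pos.2 (htb.trans hbc))) (sub_pos.2 hsb) (sub_pos.2 htb) hx hy hxy
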